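/- arXiv:2007.01300 — 3 statements merged into one kernel-verified Lean document; each statement's English description precedes it below -/
import Mathlib

section
/- Let G be a finite abelian group and S ⊆ G a symmetric subset with 0 ∉ S. For a complex character χ of G (so e_χ is real), define the finite sets of characters [χ]_ℝ = {ρ : e_ρ = e_χ and ρ is real}, [χ]_{ℝᶜ} = {ρ : e_ρ = e_χ and ρ is not real}, ~[χ]_ℝ = {ρ : e_ρ = −e_χ and ρ is real}, ~[χ]_{ℝᶜ} = {ρ : e_ρ = −e_χ and ρ is not real}, where ρ is called real if ρ⁻¹ = ρ. Then the multiplicities of ±e_χ as roots of the characteristic polynomial of A⁺ satisfy 2·m⁺(e_χ) = 2·#[χ]_ℝ + #[χ]_{ℝᶜ} + #~[χ]_{ℝᶜ} and 2·m⁺(−e_χ) = 2·#~[χ]_ℝ + #[χ]_{ℝᶜ} + #~[χ]_{ℝᶜ}. -/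
open Polynomial Matrix Finset

noncomputable section

/-- Adjacency matrix of the Cayley sum graph `X⁺(G,S)`. -/
def cayleySumAdj (G : Type*) [AddCommGroup G] [DecidableEq G] (S : Finset G) :
    Matrix G G ℝ := fun v w => if v + w ∈ S then 1 else 0

/-- `e_χ = ∑_{s ∈ S} χ s`. -/
def eSum {G : Type*} [AddCommGroup G] (S : Finset G) (χ : AddChar G ℂ) : ℂ :=
  ∑ s ∈ S, χ s

/-- A character `ρ` is real iff `ρ⁻¹ = ρ`, i.e. `ρ (-g) = ρ g` for all `g`. -/
def IsRealChar {G : Type*} [AddCommGroup G] (ρ : AddChar G ℂ) : Prop :=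
  ∀ g : G, ρ (-g) = ρ g

/-- Multiplicity of `μ : ℂ` as a root of the characteristic polynomial of a real matrix. -/
def multC {n : Type*} [Fintype n] [DecidableEq n] (M : Matrix n n ℝ) (μ : ℂ) : ℕ :=
  ((M.charpoly).map (algebraMap ℝ ℂ)).rootMultiplicity μ

/-- The Cayley sum matrix maps a character `ρ` to `e_ρ` times its inverse. -/
theorem cayleySumAdj_mulVec_addChar {G : Type*} [AddCommGroup G] [Fintype G] [DecidableEq G]
    (S : Finset G) (ρ : AddChar G ℂ) :
    (cayleySumAdj G S).map (algebraMap ℝ ℂ) *ᵥ (ρ : G → ℂ) =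
      eSum S ρ • ((ρ⁻¹ : AddChar G ℂ) : G → ℂ) := by
  ext v
  simp only [Matrix.mulVec, dotProduct, Matrix.map_apply, cayleySumAdj, Pi.smul_apply,
    smul_eq_mul, eSum, AddChar.inv_apply]
  rw [← Equiv.sum_comp (Equiv.subRight v), Finset.sum_mul]
  simp [apply_ite, sub_eq_add_neg, AddChar.map_add_eq_mul]

theorem eSum_inv {G : Type*} [AddCommGroup G] (S : Finset G) (hSym : ∀ s : G, -s ∈ S ↔ s ∈ S)
    (ρ : AddChar G ℂ) : eSum S ρ⁻¹ = eSum S ρ :=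
  Finset.sum_nbij' (- ·) (- ·) (by simp [hSym]) (by simp [hSym]) (by simp) (by simp)
    (by simp [AddChar.inv_apply])

theorem isRealChar_iff_inv_eq {G : Type*} [AddCommGroup G] (ρ : AddChar G ℂ) :
    IsRealChar ρ ↔ ρ⁻¹ = ρ := by
  simp [IsRealChar, DFunLike.ext_iff, AddChar.inv_apply]

/-- If a linear endomorphism is diagonalised by a basis, its characteristic polynomial is the
product of the corresponding linear factors. -/
theorem LinearMap.charpoly_eq_prod_of_basis {K V ι : Type*} [Field K] [AddCommGroup V] [Module K V]
    [Module.Finite K V] [Fintype ι] [DecidableEq ι] (b : Module.Basis ι K V) (f : V →ₗ[K] V)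
    (c : ι → K) (h : ∀ i, f (b i) = c i • b i) : f.charpoly = ∏ i, (X - C (c i)) := by
  have hd : LinearMap.toMatrix b b f = Matrix.diagonal c := by
    ext i j
    rw [LinearMap.toMatrix_apply, h, map_smul, Module.Basis.repr_self, Matrix.diagonal_apply]
    by_cases hij : i = j
    · subst hij
      simp
    · simp [hij]
  rw [← LinearMap.charpoly_toMatrix f b, hd, Matrix.charpoly_diagonal]

theorem charpoly_cayleySumAdj {G : Type*} [AddCommGroup G] [Fintype G] [DecidableEq G]
    [LinearOrder (AddChar G ℂ)] (S : Finset G) (hSym : ∀ s : G, -s ∈ S ↔ s ∈ S) :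
    (cayleySumAdj G S).charpoly.map (algebraMap ℝ ℂ) =
      ∏ ρ : AddChar G ℂ, (X - C (if ρ ≤ ρ⁻¹ then eSum S ρ else -eSum S ρ)) := by
  set u : AddChar G ℂ → G → ℂ := fun ρ => if ρ ≤ ρ⁻¹ then ⇑ρ + ⇑ρ⁻¹ else ⇑ρ - ⇑ρ⁻¹ with hu
  have hspan : ⊤ ≤ Submodule.span ℂ (Set.range u) := by
    rw [← (AddChar.complexBasis G).span_eq, Submodule.span_le]
    rintro _ ⟨ρ, rfl⟩
    rw [AddChar.complexBasis_apply, SetLike.mem_coe]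
    have h1 : u ρ ∈ Submodule.span ℂ (Set.range u) := Submodule.subset_span ⟨ρ, rfl⟩
    have h2 : u ρ⁻¹ ∈ Submodule.span ℂ (Set.range u) := Submodule.subset_span ⟨ρ⁻¹, rfl⟩
    rcases lt_trichotomy ρ ρ⁻¹ with h | h | h
    · have h3 := Submodule.smul_mem _ (1 / 2 : ℂ) (Submodule.sub_mem _ h1 h2)
      convert h3 using 1
      simp only [hu, inv_inv, h.le, h.not_ge, if_true, if_false]
      module
    · have h3 := Submodule.smul_mem _ (1 / 2 : ℂ) h1
      convert h3 using 1
      simp only [hu, ← h, le_refl, if_true]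
      module
    · have h3 := Submodule.smul_mem _ (1 / 2 : ℂ) (Submodule.add_mem _ h1 h2)
      convert h3 using 1
      simp only [hu, inv_inv, h.le, h.not_ge, if_true, if_false]
      module
  let b := basisOfTopLeSpanOfCardEqFinrank u hspan
    (by rw [Module.finrank_fintype_fun_eq_card, AddChar.card_eq])
  have hb : ∀ ρ, b ρ = u ρ := fun ρ => by simp [b]
  rw [← Matrix.charpoly_map, ← Matrix.charpoly_toLin']
  refine LinearMap.charpoly_eq_prod_of_basis b _ _ fun ρ => ?_
  rw [hb, Matrix.toLin'_apply]
  simp only [hu]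
  split_ifs
  · rw [Matrix.mulVec_add, cayleySumAdj_mulVec_addChar, cayleySumAdj_mulVec_addChar,
      eSum_inv S hSym, inv_inv]
    module
  · rw [Matrix.mulVec_sub, cayleySumAdj_mulVec_addChar, cayleySumAdj_mulVec_addChar,
      eSum_inv S hSym, inv_inv]
    module

theorem multC_cayleySumAdj {G : Type*} [AddCommGroup G] [Fintype G] [DecidableEq G]
    [LinearOrder (AddChar G ℂ)] (S : Finset G) (hSym : ∀ s : G, -s ∈ S ↔ s ∈ S) (μ : ℂ) :
    multC (cayleySumAdj G S) μ =
      #{ρ : AddChar G ℂ | (if ρ ≤ ρ⁻¹ then eSum S ρ else -eSum S ρ) = μ} := by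
  rw [multC, charpoly_cayleySumAdj S hSym, ← Polynomial.count_roots,
    Polynomial.roots_prod _ _ (Finset.prod_ne_zero_iff.2 fun _ _ => X_sub_C_ne_zero _)]
  simp only [roots_X_sub_C, Multiset.bind_singleton, Multiset.count_map]
  simp only [eq_comm (a := μ)]
  rfl

/-- Among the non-real characters with a given value of `e`, inversion exchanges the ones below
and above their inverse. -/
theorem card_not_isRealChar {G : Type*} [AddCommGroup G] [Fintype G]
    [LinearOrder (AddChar G ℂ)] (S : Finset G) (hSym : ∀ s : G, -s ∈ S ↔ s ∈ S) (μ : ℂ) :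
    Nat.card {ρ : AddChar G ℂ // eSum S ρ = μ ∧ ¬ IsRealChar ρ} =
        2 * #{ρ : AddChar G ℂ | eSum S ρ = μ ∧ ρ < ρ⁻¹} ∧
      Nat.card {ρ : AddChar G ℂ // eSum S ρ = μ ∧ ¬ IsRealChar ρ} =
        2 * #{ρ : AddChar G ℂ | eSum S ρ = μ ∧ ρ⁻¹ < ρ} := by
  classical
  have hcard : #{ρ : AddChar G ℂ | eSum S ρ = μ ∧ ρ < ρ⁻¹} =
      #{ρ : AddChar G ℂ | eSum S ρ = μ ∧ ρ⁻¹ < ρ} :=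
    Finset.card_nbij' (·⁻¹) (·⁻¹) (fun ρ => by simp [eSum_inv S hSym])
      (fun ρ => by simp [eSum_inv S hSym]) (fun ρ _ => inv_inv ρ) (fun ρ _ => inv_inv ρ)
  have hsum : Nat.card {ρ : AddChar G ℂ // eSum S ρ = μ ∧ ¬ IsRealChar ρ} =
      #{ρ : AddChar G ℂ | eSum S ρ = μ ∧ ρ < ρ⁻¹} +
        #{ρ : AddChar G ℂ | eSum S ρ = μ ∧ ρ⁻¹ < ρ} := by
    rw [Nat.card_eq_fintype_card, Fintype.card_subtype, ← Finset.card_union_of_disjoint]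
    · congr 1
      ext ρ
      simp only [mem_filter, mem_univ, true_and, mem_union, isRealChar_iff_inv_eq,
        ← and_or_left, ← ne_eq, ne_iff_lt_or_gt, or_comm (a := ρ⁻¹ < ρ)]
    · rw [Finset.disjoint_filter]
      exact fun ρ _ h h' => lt_asymm h.2 h'.2
  omega

theorem two_mul_multC_cayleySumAdj {G : Type*} [AddCommGroup G] [Fintype G] [DecidableEq G]
    (S : Finset G) (hSym : ∀ s : G, -s ∈ S ↔ s ∈ S) (μ : ℂ) :
    2 * multC (cayleySumAdj G S) μ =
      2 * Nat.card {ρ : AddChar G ℂ // eSum S ρ = μ ∧ IsRealChar ρ}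
        + Nat.card {ρ : AddChar G ℂ // eSum S ρ = μ ∧ ¬ IsRealChar ρ}
        + Nat.card {ρ : AddChar G ℂ // eSum S ρ = -μ ∧ ¬ IsRealChar ρ} := by
  classical
  let : LinearOrder (AddChar G ℂ) := linearOrderOfSTO WellOrderingRel
  rw [(card_not_isRealChar S hSym μ).1, (card_not_isRealChar S hSym (-μ)).2,
    ← mul_add, ← mul_add, multC_cayleySumAdj S hSym, Nat.card_eq_fintype_card,
    Fintype.card_subtype, ← Finset.card_union_of_disjoint, ← Finset.card_union_of_disjoint]
  · congr 2
    ext ρ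
    simp only [mem_filter, mem_univ, true_and, mem_union, isRealChar_iff_inv_eq]
    rcases lt_trichotomy ρ ρ⁻¹ with h | h | h
    · simp [h, h.le, h.ne', h.not_gt]
    · simp [← h]
    · simp [h, h.not_ge, h.ne, h.not_gt, neg_eq_iff_eq_neg]
  · rw [Finset.disjoint_left]
    intro ρ
    simp only [mem_filter, mem_univ, true_and, mem_union, isRealChar_iff_inv_eq]
    rintro (⟨_, h⟩ | ⟨_, h⟩) ⟨_, h'⟩
    · exact h'.ne h
    · exact lt_asymm h h'
  · rw [Finset.disjoint_filter]
    intro ρ _ h h'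
    exact h'.2.ne' ((isRealChar_iff_inv_eq ρ).1 h.2)

/-- multiplicities of `±e_χ` in the Cayley sum graph `X⁺(G,S)` for a symmetric
subset `S` with `0 ∉ S` of a finite abelian group `G`, in terms of the character classes
`[χ]_ℝ, [χ]_{ℝᶜ}, ~[χ]_ℝ, ~[χ]_{ℝᶜ}`. -/
theorem stmt1 {G : Type*} [AddCommGroup G] [Fintype G] [DecidableEq G]
    (S : Finset G) (hS0 : (0 : G) ∉ S) (hSym : ∀ s : G, -s ∈ S ↔ s ∈ S)
    (χ : AddChar G ℂ) :
    2 * multC (cayleySumAdj G S) (eSum S χ) =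
        2 * Nat.card {ρ : AddChar G ℂ // eSum S ρ = eSum S χ ∧ IsRealChar ρ}
        + Nat.card {ρ : AddChar G ℂ // eSum S ρ = eSum S χ ∧ ¬ IsRealChar ρ}
        + Nat.card {ρ : AddChar G ℂ // eSum S ρ = -eSum S χ ∧ ¬ IsRealChar ρ} ∧
    2 * multC (cayleySumAdj G S) (-eSum S χ) =
        2 * Nat.card {ρ : AddChar G ℂ // eSum S ρ = -eSum S χ ∧ IsRealChar ρ}
        + Nat.card {ρ : AddChar G ℂ // eSum S ρ = eSum S χ ∧ ¬ IsRealChar ρ}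
        + Nat.card {ρ : AddChar G ℂ // eSum S ρ = -eSum S χ ∧ ¬ IsRealChar ρ} := by
  refine ⟨two_mul_multC_cayleySumAdj S hSym _, ?_⟩
  rw [two_mul_multC_cayleySumAdj S hSym, neg_neg]
  ring

end
end

section
/- Let G be a finite abelian group and S ⊆ G a symmetric subset with 0 ∉ S, and let A and A⁺ be the adjacency matrices of X(G,S) and X⁺(G,S). Then for every real number λ, m(λ) + m(−λ) = m⁺(λ) + m⁺(−λ), where m(λ) (resp. m⁺(λ)) denotes the multiplicity of λ as a root of the characteristic polynomial of A (resp. A⁺). In particular m(0) = m⁺(0). -/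
open Polynomial Matrix Finset

noncomputable section

/-- Adjacency matrix of the Cayley graph `X(G,S)`. -/
def cayleyAdj (G : Type*) [AddCommGroup G] [DecidableEq G] (S : Finset G) :
    Matrix G G ℝ := fun v w => if w - v ∈ S then 1 else 0

/-- The product `χ_M(X) χ_M(-X)` depends only on `M * M`. -/
theorem Matrix.charpoly_mul_charpoly_comp_neg_X {n R : Type*} [Fintype n] [DecidableEq n]
    [CommRing R] (M : Matrix n n R) :
    M.charpoly * M.charpoly.comp (-X) =
      ((C : R →+* R[X]).mapMatrix (M * M) - Matrix.scalar n (X ^ 2 : R[X])).det := by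
  have hneg : M.charpoly.comp (-X) =
      (-Matrix.scalar n (X : R[X]) - (C : R →+* R[X]).mapMatrix M).det := by
    rw [← coe_compRingHom_apply, Matrix.charpoly, RingHom.map_det]
    congr 1
    ext1 i j
    by_cases hij : i = j <;> simp [hij]
  have hcomm : Commute (Matrix.scalar n (X : R[X])) ((C : R →+* R[X]).mapMatrix M) :=
    Matrix.scalar_commute _ (fun _ => Commute.all _ _) _
  rw [hneg, Matrix.charpoly, ← Matrix.det_mul, charmatrix, map_mul, map_pow]
  congr 1
  rw [sub_mul, mul_sub, mul_sub, hcomm.eq]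
  noncomm_ring

theorem Polynomial.rootMultiplicity_comp_neg_X {R : Type*} [CommRing R] (p : R[X]) (a : R) :
    (p.comp (-X)).rootMultiplicity a = p.rootMultiplicity (-a) := by
  simpa using rootMultiplicity_comp_C_mul_X_add_C p (-1) 0 a isUnit_one.neg

/-- Matrices with the same square have the same eigenvalue multiplicities up to sign. -/
theorem Matrix.rootMultiplicity_charpoly_add_neg_of_mul_self_eq {n R : Type*} [Fintype n]
    [DecidableEq n] [CommRing R] [IsDomain R] {M N : Matrix n n R} (h : M * M = N * N) (a : R) :
    M.charpoly.rootMultiplicity a + M.charpoly.rootMultiplicity (-a) =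
      N.charpoly.rootMultiplicity a + N.charpoly.rootMultiplicity (-a) := by
  have hne (K : Matrix n n R) : K.charpoly * K.charpoly.comp (-X) ≠ 0 := by
    refine mul_ne_zero K.charpoly_monic.ne_zero fun h0 => K.charpoly_monic.ne_zero ?_
    simpa [comp_assoc] using congrArg (fun p : R[X] => p.comp (-X)) h0
  rw [← rootMultiplicity_comp_neg_X, ← rootMultiplicity_comp_neg_X,
    ← rootMultiplicity_mul (hne M), ← rootMultiplicity_mul (hne N),
    charpoly_mul_charpoly_comp_neg_X, charpoly_mul_charpoly_comp_neg_X, h]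

theorem cayleyAdj_mul_self {G : Type*} [AddCommGroup G] [Fintype G] [DecidableEq G]
    (S : Finset G) (hSym : ∀ s : G, -s ∈ S ↔ s ∈ S) :
    cayleyAdj G S * cayleyAdj G S = cayleySumAdj G S * cayleySumAdj G S := by
  ext v u
  rw [Matrix.mul_apply, Matrix.mul_apply]
  refine Fintype.sum_equiv (Equiv.neg G) _ _ fun w => ?_
  have hvw : v + -w ∈ S ↔ w - v ∈ S := by
    rw [← hSym (w - v), neg_sub, sub_eq_add_neg]
  have hwu : -w + u ∈ S ↔ u - w ∈ S := by rw [neg_add_eq_sub]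
  simp only [cayleyAdj, cayleySumAdj, Equiv.neg_apply, hvw, hwu]

/-- for a symmetric subset `S` (with `0 ∉ S`) of a finite abelian group `G`,
for every real `λ` the multiplicities as roots of the characteristic polynomials satisfy
`m(λ) + m(−λ) = m⁺(λ) + m⁺(−λ)`; in particular `m(0) = m⁺(0)`. -/
theorem stmt2 {G : Type*} [AddCommGroup G] [Fintype G] [DecidableEq G]
    (S : Finset G) (hS0 : (0 : G) ∉ S) (hSym : ∀ s : G, -s ∈ S ↔ s ∈ S) :
    (∀ lam : ℝ,
      (cayleyAdj G S).charpoly.rootMultiplicity lam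
        + (cayleyAdj G S).charpoly.rootMultiplicity (-lam) =
      (cayleySumAdj G S).charpoly.rootMultiplicity lam
        + (cayleySumAdj G S).charpoly.rootMultiplicity (-lam)) ∧
    (cayleyAdj G S).charpoly.rootMultiplicity 0 =
      (cayleySumAdj G S).charpoly.rootMultiplicity 0 := by
  have hmult := Matrix.rootMultiplicity_charpoly_add_neg_of_mul_self_eq
    (cayleyAdj_mul_self S hSym)
  refine ⟨hmult, ?_⟩
  have h0 := hmult 0
  rw [neg_zero] at h0
  omega

end
end

section
/- Let R be a finite commutative local ring with identity 1 ≠ 0 whose cardinality is even. Then for all x, y ∈ R, x − y is a unit of R if and only if x + y is a unit of R (that is, G_R = G_R⁺). In particular, G_R⁺ has no loops: x + x is never a unit. -/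
/-- In a finite commutative ring of even cardinality, `2` is not a unit. -/
theorem not_isUnit_two_of_even_card {R : Type*} [CommRing R] [Fintype R]
    (heven : Even (Fintype.card R)) : ¬ IsUnit (2 : R) := by
  intro h
  have : Fact (Nat.Prime 2) := ⟨Nat.prime_two⟩
  obtain ⟨a, ha⟩ := exists_prime_addOrderOf_dvd_card (G := R) 2 heven.two_dvd
  have h2a : (2 : R) * a = 0 := by
    simpa [ha, two_mul, two_nsmul] using addOrderOf_nsmul_eq_zero a
  have ha0 : a = 0 := h.mul_right_eq_zero.mp h2a
  simp [ha0] at ha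

/-- if `R` is a finite commutative local ring with `1 ≠ 0` of even cardinality,
then for all `x, y ∈ R`, `x − y` is a unit iff `x + y` is a unit (so `G_R = G_R⁺`);
in particular `x + x` is never a unit (`G_R⁺` has no loops). -/
theorem stmt6 {R : Type*} [CommRing R] [IsLocalRing R] [Fintype R] [Nontrivial R]
    (heven : Even (Fintype.card R)) :
    (∀ x y : R, IsUnit (x - y) ↔ IsUnit (x + y)) ∧ (∀ x : R, ¬ IsUnit (x + x)) := by
  have hdouble (x : R) : ¬ IsUnit (x + x) := fun h =>
    not_isUnit_two_of_even_card heven (isUnit_of_mul_isUnit_left (two_mul x ▸ h))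
  refine ⟨fun x y => ⟨fun h => ?_, fun h => ?_⟩, hdouble⟩
  · have hsum : x - y = (x + y) + -(y + y) := by ring
    exact (IsLocalRing.isUnit_or_isUnit_of_isUnit_add (hsum ▸ h)).resolve_right
      fun hy => hdouble y (IsUnit.neg_iff _ |>.mp hy)
  · have hsum : x + y = (x - y) + (y + y) := by ring
    exact (IsLocalRing.isUnit_or_isUnit_of_isUnit_add (hsum ▸ h)).resolve_right (hdouble y)
end
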